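/- Let ℓ ≥ 2 and let B be a symmetric negative semidefinite ℓ×ℓ real matrix. Let r ∈ ℝ^ℓ be a vector with all entries strictly positive such that B·r = 0 and such that every vector v with B·v = 0 is a scalar multiple of r. Assume moreover that the first and last entries of r are equal, i.e. r_0 = r_{ℓ-1}. Suppose a ∈ ℝ^ℓ satisfies (B·a)_0 = -1 and (B·a)_i = 0 for every index i with 1 ≤ i ≤ ℓ-2 (no condition is imposed on (B·a)_{ℓ-1}). Then a_0 ≠ a_{ℓ-1}. -/

import Mathlib

open Matrix

/-- A vector isotropic for a symmetric negative semidefinite real matrix lies in its kernel. -/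
theorem mulVec_eq_zero_of_isSymm_of_dotProduct_mulVec_eq_zero {n : Type*} [Fintype n]
    {B : Matrix n n ℝ} (hB : B.IsSymm) (hnsd : ∀ v : n → ℝ, v ⬝ᵥ B *ᵥ v ≤ 0)
    {a : n → ℝ} (ha : a ⬝ᵥ B *ᵥ a = 0) : B *ᵥ a = 0 := by
  have hpsd : (-B).PosSemidef := by
    refine .of_dotProduct_mulVec_nonneg ?_ fun v => ?_
    · simpa [IsHermitian, conjTranspose_eq_transpose_of_trivial] using hB.eq
    · simpa [neg_mulVec] using hnsd v
  simpa [neg_mulVec, ha] using hpsd.dotProduct_mulVec_zero_iff a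

/-- The dot product with a vector supported on two distinct indices. -/
theorem dotProduct_eq_add_of_forall_ne {n R : Type*} [Fintype n] [NonUnitalNonAssocSemiring R]
    {i j : n} (hij : i ≠ j) {u : n → R} (hu : ∀ k, k ≠ i → k ≠ j → u k = 0) (w : n → R) :
    w ⬝ᵥ u = w i * u i + w j * u j :=
  Fintype.sum_eq_add i j hij fun k hk => by rw [hu k hk.1 hk.2, mul_zero]

/-- Linear-algebra core of the paper's Lemma 2.2 (boundary non-torsion):
`B` is the (symmetric, negative semidefinite) intersection matrix of the
components of a degenerate fiber, with kernel spanned by the positive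
multiplicity vector `r` whose first and last entries agree; if `(B·a)₀ = -1`
and `(B·a)ᵢ = 0` for `1 ≤ i ≤ ℓ-2`, then `a₀ ≠ a_{ℓ-1}`. -/
theorem boundary_coeffs_ne (ℓ : ℕ) (hℓ : 2 ≤ ℓ)
    (B : Matrix (Fin ℓ) (Fin ℓ) ℝ)
    (hBsymm : B.IsSymm)
    (hBnsd : ∀ v : Fin ℓ → ℝ, v ⬝ᵥ B.mulVec v ≤ 0)
    (r : Fin ℓ → ℝ) (hrpos : ∀ i, 0 < r i)
    (hBr : B.mulVec r = 0)
    (hker : ∀ v : Fin ℓ → ℝ, B.mulVec v = 0 → ∃ c : ℝ, v = c • r)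
    (hr : r ⟨0, by omega⟩ = r ⟨ℓ - 1, by omega⟩)
    (a : Fin ℓ → ℝ)
    (ha0 : B.mulVec a ⟨0, by omega⟩ = -1)
    (hai : ∀ i : Fin ℓ, 1 ≤ (i : ℕ) → (i : ℕ) ≤ ℓ - 2 → B.mulVec a i = 0) :
    a ⟨0, by omega⟩ ≠ a ⟨ℓ - 1, by omega⟩ := by
  intro h
  have hdot := dotProduct_eq_add_of_forall_ne
    (i := (⟨0, by omega⟩ : Fin ℓ)) (j := ⟨ℓ - 1, by omega⟩) (u := B *ᵥ a)
    (by simp only [ne_eq, Fin.mk.injEq]; omega)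
    (fun k hk₀ hk₁ => by
      simp only [ne_eq, Fin.ext_iff] at hk₀ hk₁
      exact hai k (by omega) (by omega))
  have hr_dot : r ⬝ᵥ B *ᵥ a = 0 := by
    rw [dotProduct_mulVec, ← mulVec_transpose, hBsymm.eq, hBr, zero_dotProduct]
  have hlast : (B *ᵥ a) ⟨ℓ - 1, by omega⟩ = 1 := by
    have hr_eq := hdot r
    rw [hr_dot, ha0, ← hr] at hr_eq
    exact mul_left_cancel₀ (hrpos ⟨0, by omega⟩).ne' (by linarith)
  have hisotropic : a ⬝ᵥ B *ᵥ a = 0 := by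
    rw [hdot a, ha0, hlast, h]
    ring
  have hBa := mulVec_eq_zero_of_isSymm_of_dotProduct_mulVec_eq_zero hBsymm hBnsd hisotropic
  rw [hBa] at ha0
  norm_num at ha0
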